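/- For all δ > 0 there exist A = A(δ) > 0, ε = ε(δ) > 0 and η = η(δ) > 0 with the following property. Let x₀ ∈ Σ ⊆ ℝ⁴ and r₀ > 0. Suppose that ϑ^C_Σ(x,r) < ε for all x ∈ Σ ∩ B(x₀,r₀) and 0 < r ≤ r₀, and that C is a KP cone based at x₀ with D^{x₀,r₀}(Σ,C) < η. Then for every x ∈ Σ with r₀/3 ≤ |x−x₀| ≤ 2r₀/3 and every 0 < r ≤ |x−x₀|/A, one has θ^P_Σ(x,r) < δ. -/

import Mathlib

open Metric Set MeasureTheory Filter Module
open scoped RealInnerProductSpace Topology Pointwise ENNReal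

noncomputable section

/-- `ℝⁿ` as a Euclidean space. -/
abbrev E (n : ℕ) : Type := EuclideanSpace ℝ (Fin n)

/-- `d(A,B) = sup_{a ∈ A} inf_{b ∈ B} |a - b|`. -/
def setD {n : ℕ} (A B : Set (E n)) : ℝ := ⨆ a ∈ A, Metric.infDist a B

/-- `d^{x,r}(A,B) = (1/r) d(A ∩ B(x,r), B ∩ B(x,r))`. -/
def dxr {n : ℕ} (x : E n) (r : ℝ) (A B : Set (E n)) : ℝ :=
  (1 / r) * setD (A ∩ closedBall x r) (B ∩ closedBall x r)

/-- `D^{x,r}(A,B) = max(d^{x,r}(A,B), d^{x,r}(B,A))`. -/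
def Dxr {n : ℕ} (x : E n) (r : ℝ) (A B : Set (E n)) : ℝ :=
  max (dxr x r A B) (dxr x r B A)

/-- `d̃^{x,r}(A,B) = (1/r) d(A ∩ B(x,r), B)`. -/
def dtxr {n : ℕ} (x : E n) (r : ℝ) (A B : Set (E n)) : ℝ :=
  (1 / r) * setD (A ∩ closedBall x r) B

/-- `D̃^{x,r}(A,B) = max(d̃^{x,r}(A,B), d̃^{x,r}(B,A))`. -/
def Dtxr {n : ℕ} (x : E n) (r : ℝ) (A B : Set (E n)) : ℝ :=
  max (dtxr x r A B) (dtxr x r B A)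

/-- `C` is a cone based at `y`: `y ∈ C` and `s • (C − y) = C − y` for all `s > 0`. -/
def IsConeAt {n : ℕ} (y : E n) (C : Set (E n)) : Prop :=
  y ∈ C ∧ ∀ s : ℝ, 0 < s → s • {z : E n | y + z ∈ C} = {z : E n | y + z ∈ C}

/-- The standard KP cone `{x₄² = x₁² + x₂² + x₃²}` in `ℝⁿ`, `n ≥ 4`. -/
def stdKP (n : ℕ) (hn : 4 ≤ n) : Set (E n) :=
  {x : E n | (x ⟨3, by omega⟩) ^ 2 =
    (x ⟨0, by omega⟩) ^ 2 + (x ⟨1, by omega⟩) ^ 2 + (x ⟨2, by omega⟩) ^ 2}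

/-- `C` is a KP cone based at `y`: in some orthonormal coordinates centered at the origin,
`C − y` is the standard KP cone. -/
def IsKPCone {n : ℕ} (hn : 4 ≤ n) (y : E n) (C : Set (E n)) : Prop :=
  ∃ f : E n ≃ₗᵢ[ℝ] E n, {z : E n | y + z ∈ C} = f ⁻¹' stdKP n hn

/-- `θ^P_Σ(x,r)` : best approximation of `S` in `B(x,r)` by affine `m`-planes through `x`. -/
def thetaP {n : ℕ} (m : ℕ) (S : Set (E n)) (x : E n) (r : ℝ) : ℝ :=
  ⨅ L : {L : AffineSubspace ℝ (E n) // x ∈ L ∧ Module.finrank ℝ L.direction = m},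
    Dxr x r S (L.1 : Set (E n))

/-- `θ^C_Σ(x,r)` : best approximation of `S` in `B(x,r)` by KP cones based at `x`. -/
def thetaC {n : ℕ} (hn : 4 ≤ n) (S : Set (E n)) (x : E n) (r : ℝ) : ℝ :=
  ⨅ C : {C : Set (E n) // IsKPCone hn x C}, Dxr x r S C.1

/-- `ϑ^C_Σ(x,r)` : best approximation of `S` in `B(x,r)` by KP cones containing `x`. -/
def varthetaC {n : ℕ} (hn : 4 ≤ n) (S : Set (E n)) (x : E n) (r : ℝ) : ℝ :=
  ⨅ C : {C : Set (E n) // (∃ y, IsKPCone hn y C) ∧ x ∈ C}, Dxr x r S C.1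

/-- The angle `∠(P₁,P₂) = arcsin Γ(P₁,P₂)` between two affine planes. -/
def planeAngle {n : ℕ} (P₁ P₂ : AffineSubspace ℝ (E n)) : ℝ :=
  Real.arcsin (dxr (0 : E n) 1 (P₁.direction : Set (E n)) (P₂.direction : Set (E n)))

/-- The support of a measure. -/
def msupp {n : ℕ} (μ : Measure (E n)) : Set (E n) :=
  {x : E n | ∀ r : ℝ, 0 < r → 0 < μ (closedBall x r)}

/-- Weak convergence of a sequence of measures in the sense of Radon measures. -/
def VagueTendsto {n : ℕ} (μs : ℕ → Measure (E n)) (ν : Measure (E n)) : Prop :=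
  ∀ f : E n → ℝ, Continuous f → HasCompactSupport f →
    Tendsto (fun i => ∫ y, f y ∂(μs i)) atTop (nhds (∫ y, f y ∂ν))

/-- `ν` is a tangent measure of `μ` at `x`: `ν ≠ 0` and for some `rᵢ ↓ 0`, `cᵢ > 0`,
`cᵢ (T_{x,rᵢ})₊μ → ν` weakly. -/
def IsTangentMeasure {n : ℕ} (μ ν : Measure (E n)) (x : E n) : Prop :=
  ν ≠ 0 ∧ ∃ r c : ℕ → ℝ, (∀ i, 0 < r i) ∧ Tendsto r atTop (nhds 0) ∧ (∀ i, 0 < c i) ∧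
    VagueTendsto (fun i => ENNReal.ofReal (c i) • Measure.map (fun y => (r i)⁻¹ • (y - x)) μ) ν

/-- `μ` is `m`-asymptotically optimally doubling. -/
def AOD {n : ℕ} (m : ℕ) (μ : Measure (E n)) : Prop :=
  ∀ K : Set (E n), K ⊆ msupp μ → IsCompact K → ∀ δ : ℝ, 0 < δ →
    ∃ r₀ : ℝ, 0 < r₀ ∧ ∀ x ∈ K, ∀ r : ℝ, 0 < r → r ≤ r₀ →
      ∀ τ : ℝ, τ ∈ Set.Icc (1/2 : ℝ) 1 →
        |(μ (closedBall x (τ * r))).toReal / (μ (closedBall x r)).toReal - τ ^ m| < δ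

/-- `ν` is `m`-flat: `m`-dimensional Hausdorff measure restricted to an affine `m`-plane. -/
def IsFlatMeasure {n : ℕ} (m : ℕ) (ν : Measure (E n)) : Prop :=
  ∃ L : AffineSubspace ℝ (E n), (L : Set (E n)).Nonempty ∧
    Module.finrank ℝ L.direction = m ∧
    ν = (Measure.hausdorffMeasure (m : ℝ)).restrict (L : Set (E n))

/-- Volume of the unit ball in `ℝᵐ`. -/
def unitBallVol (m : ℕ) : ℝ := (volume (Metric.ball (0 : EuclideanSpace ℝ (Fin m)) 1)).toReal

/-- `ω₃`, the volume of the unit `3`-ball. -/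
def omega3 : ℝ := unitBallVol 3

/-- The second moment `Q_{0,r}` of a measure on `ℝ⁴`. -/
def Qmom (μ : Measure (E 4)) (r : ℝ) (z : E 4) : ℝ :=
  (5 / (omega3 * r ^ 5)) * ∫ w in closedBall (0 : E 4) r, ⟪z, w⟫ ^ 2 ∂μ

/-- Entries `q_{ij}` of the second moment matrix in given directions. -/
def qmom (μ : Measure (E 4)) (r : ℝ) (u v : E 4) : ℝ :=
  (5 / (omega3 * r ^ 5)) * ∫ w in closedBall (0 : E 4) r, ⟪u, w⟫ * ⟪v, w⟫ ∂μ

/-- `μ` is `(α,m)`-Hölder asymptotically uniform. -/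
def HolderAsympUniform {n : ℕ} (α : ℝ) (m : ℕ) (μ : Measure (E n)) : Prop :=
  ∀ K : Set (E n), K ⊆ msupp μ → IsCompact K →
    ∃ C r₀ : ℝ, 0 < r₀ ∧ ∀ x ∈ K, ∀ r : ℝ, 0 < r → r ≤ r₀ →
      |(μ (closedBall x r)).toReal / (unitBallVol m * r ^ m) - 1| ≤ C * r ^ α

/-- `φ` is a `C^{1,β}` diffeomorphism from `U` onto `U'`: a continuously differentiable bijection
with `β`-Hölder derivative whose inverse is also `C^{1,β}`. -/
def IsC1HolderDiffeoOn (β : ℝ) (U U' : Set (E 4)) (φ : E 4 → E 4) : Prop :=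
  Set.BijOn φ U U' ∧
  (∀ x ∈ U, HasFDerivAt φ (fderiv ℝ φ x) x) ∧
  (∃ M : ℝ, ∀ x ∈ U, ∀ y ∈ U, ‖fderiv ℝ φ x - fderiv ℝ φ y‖ ≤ M * ‖x - y‖ ^ β) ∧
  ∃ ψ : E 4 → E 4, Set.BijOn ψ U' U ∧
    (∀ x ∈ U, ψ (φ x) = x) ∧ (∀ y ∈ U', φ (ψ y) = y) ∧
    (∀ y ∈ U', HasFDerivAt ψ (fderiv ℝ ψ y) y) ∧
    (∃ M : ℝ, ∀ x ∈ U', ∀ y ∈ U', ‖fderiv ℝ ψ x - fderiv ℝ ψ y‖ ≤ M * ‖x - y‖ ^ β)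

lemma aux_infDist_le {n : ℕ} (A B : Set (E n)) (hA : Bornology.IsBounded A) (hB : B.Nonempty)
    {a : E n} (ha : a ∈ A) : Metric.infDist a B ≤ setD A B := by
  obtain ⟨b, hb⟩ := hB
  obtain ⟨K, hK⟩ := hA.subset_closedBall b
  have hbd : BddAbove (Set.range fun a : E n => ⨆ (_ : a ∈ A), Metric.infDist a B) := by
    refine ⟨max K 0, ?_⟩
    rintro _ ⟨c, rfl⟩
    refine Real.iSup_le (fun hc => ?_) (le_max_right _ _)
    exact (Metric.infDist_le_dist_of_mem hb).trans ((mem_closedBall.1 (hK hc)).trans (le_max_left _ _))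
  have h := le_ciSup hbd a
  have h2 : (⨆ (_ : a ∈ A), Metric.infDist a B) = Metric.infDist a B := by
    have : Nonempty (a ∈ A) := ⟨ha⟩
    exact ciSup_const
  simp only [h2] at h
  exact h

lemma aux_setD_nonneg {n : ℕ} (A B : Set (E n)) : 0 ≤ setD A B :=
  Real.iSup_nonneg fun _ => Real.iSup_nonneg fun _ => Metric.infDist_nonneg

lemma aux_setD_le {n : ℕ} (A B : Set (E n)) (c : ℝ) (hc : 0 ≤ c)
    (h : ∀ a ∈ A, ∃ b ∈ B, dist a b ≤ c) : setD A B ≤ c := by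
  refine Real.iSup_le (fun a => Real.iSup_le (fun ha => ?_) hc) hc
  obtain ⟨b, hb, hab⟩ := h a ha
  exact (Metric.infDist_le_dist_of_mem hb).trans hab

lemma aux_dxr_nonneg {n : ℕ} (x : E n) (r : ℝ) (hr : 0 < r) (A B : Set (E n)) :
    0 ≤ dxr x r A B := mul_nonneg (by positivity) (aux_setD_nonneg _ _)

lemma aux_dxr_lt {n : ℕ} (x : E n) (r : ℝ) (hr : 0 < r) (A B : Set (E n)) (c : ℝ)
    (hB : (B ∩ closedBall x r).Nonempty) (h : dxr x r A B < c) :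
    ∀ a ∈ A, dist a x ≤ r → ∃ b ∈ B, dist b x ≤ r ∧ dist a b ≤ c * r := by
  intro a ha har
  have h1 := aux_infDist_le (A ∩ closedBall x r) (B ∩ closedBall x r)
    (isBounded_closedBall.subset inter_subset_right) hB (a := a) ⟨ha, har⟩
  have h2 : setD (A ∩ closedBall x r) (B ∩ closedBall x r) < c * r := by
    unfold dxr at h
    rw [one_div, inv_mul_lt_iff₀ hr] at h
    linarith
  obtain ⟨b, hb, hb2⟩ := (Metric.infDist_lt_iff hB).1 (h1.trans_lt h2)
  exact ⟨b, hb.1, hb.2, hb2.le⟩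

lemma aux_Dxr_lt {n : ℕ} (x : E n) (r : ℝ) (hr : 0 < r) (A B : Set (E n)) (c : ℝ)
    (hxA : x ∈ A) (hxB : x ∈ B) (h : Dxr x r A B < c) :
    (∀ a ∈ A, dist a x ≤ r → ∃ b ∈ B, dist b x ≤ r ∧ dist a b ≤ c * r) ∧
    (∀ a ∈ B, dist a x ≤ r → ∃ b ∈ A, dist b x ≤ r ∧ dist a b ≤ c * r) := by
  have h' := max_lt_iff.1 h
  exact ⟨aux_dxr_lt x r hr A B c ⟨x, hxB, mem_closedBall_self hr.le⟩ h'.1,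
    aux_dxr_lt x r hr B A c ⟨x, hxA, mem_closedBall_self hr.le⟩ h'.2⟩

lemma aux_dxr_le {n : ℕ} (x : E n) (r : ℝ) (hr : 0 < r) (A B : Set (E n)) (c : ℝ) (hc : 0 ≤ c)
    (h : ∀ a ∈ A, dist a x ≤ r → ∃ b ∈ B, dist b x ≤ r ∧ dist a b ≤ c * r) :
    dxr x r A B ≤ c := by
  unfold dxr
  rw [one_div, inv_mul_le_iff₀ hr, mul_comm r c]
  refine aux_setD_le _ _ _ (by positivity) ?_
  rintro a ⟨ha, har⟩
  obtain ⟨b, hb, h1, h2⟩ := h a ha har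
  exact ⟨b, ⟨hb, h1⟩, h2⟩

lemma aux_kp {y : E 4} {C : Set (E 4)} (h : IsKPCone (le_refl 4) y C) :
    ∃ e v : E 4, inner ℝ e e = (1 : ℝ) ∧ inner ℝ v v = (1 : ℝ) ∧ inner ℝ e v = (0 : ℝ) ∧
      ∀ z, y + z ∈ C ↔ 2 * (inner ℝ z e) ^ 2 = inner ℝ z z := by
  obtain ⟨f, hf⟩ := h
  refine ⟨f.symm (EuclideanSpace.single 3 1), f.symm (EuclideanSpace.single 0 1), ?_, ?_, ?_, ?_⟩
  · rw [f.symm.inner_map_map]; simp [EuclideanSpace.inner_single_left]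
  · rw [f.symm.inner_map_map]; simp [EuclideanSpace.inner_single_left]
  · rw [f.symm.inner_map_map]; simp [EuclideanSpace.inner_single_left]
  · intro z
    have h1 : y + z ∈ C ↔ z ∈ f ⁻¹' stdKP 4 (le_refl 4) := by rw [← hf]; rfl
    rw [h1]
    have h2 : inner ℝ z (f.symm (EuclideanSpace.single 3 1)) = (f z) 3 := by
      rw [← f.inner_map_map]; simp [EuclideanSpace.inner_single_right]
    have h3 : inner ℝ z z = (f z 0)^2 + (f z 1)^2 + (f z 2)^2 + (f z 3)^2 := by
      rw [← f.inner_map_map, PiLp.inner_apply]; simp [Fin.sum_univ_four]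
    rw [h2, h3]
    show (f z 3)^2 = (f z 0)^2 + (f z 1)^2 + (f z 2)^2 ↔ _
    constructor <;> intro h <;> linarith

/-- frame lemma -/
lemma aux_frame {y x : E 4} {C : Set (E 4)} (h : IsKPCone (le_refl 4) y C) (hx : x ∈ C) :
    ∃ μ ν : E 4, inner ℝ μ μ = (1 : ℝ) ∧ inner ℝ ν ν = (1 : ℝ) ∧ inner ℝ μ ν = (0 : ℝ) ∧
      ∀ z, x + z ∈ C ↔ (inner ℝ z μ + inner ℝ z ν) ^ 2 - inner ℝ z z
        = 2 * ‖y - x‖ * inner ℝ z ν := by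
  obtain ⟨e, v, he, hv, hev, hC⟩ := aux_kp h
  by_cases hxy : y = x
  · subst hxy
    have hve : inner ℝ v e = (0 : ℝ) := by rw [real_inner_comm]; exact hev
    have h2 : (√2)⁻¹ * (√2)⁻¹ = (1/2 : ℝ) := by
      rw [← mul_inv, Real.mul_self_sqrt (by norm_num)]; norm_num
    refine ⟨(√2)⁻¹ • (e - v), (√2)⁻¹ • (e + v), ?_, ?_, ?_, ?_⟩
    · simp only [inner_smul_left, inner_smul_right, inner_sub_left, inner_sub_right, he, hv, hev, hve,
        conj_trivial]
      linear_combination 2 * h2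
    · simp only [inner_smul_left, inner_smul_right, inner_add_left, inner_add_right, he, hv, hev, hve,
        conj_trivial]
      linear_combination 2 * h2
    · simp only [inner_smul_left, inner_smul_right, inner_add_left, inner_add_right, inner_sub_left,
        inner_sub_right, he, hv, hev, hve, conj_trivial]
      ring
    · intro z
      rw [hC z]
      simp only [inner_smul_right, inner_add_right, inner_sub_right, sub_self, norm_zero]
      constructor
      · intro h; linear_combination h + 4 * (inner ℝ z e)^2 * h2
      · intro h; linear_combination h - 4 * (inner ℝ z e)^2 * h2
  · set Y := y - x with hY
    have hρ : 0 < ‖Y‖ := norm_pos_iff.2 (sub_ne_zero.2 hxy)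
    have hYY : inner ℝ Y Y = ‖Y‖ * ‖Y‖ := real_inner_self_eq_norm_mul_norm Y
    have hY0 : 2 * (inner ℝ Y e) ^ 2 = ‖Y‖ * ‖Y‖ := by
      have := (hC (-Y)).1 (by rw [hY]; simpa using hx)
      rw [← pow_two]
      simpa [inner_neg_left, inner_neg_right, hYY] using this
    set ρ := ‖Y‖
    set k := inner ℝ Y e with hk
    have hk' : inner ℝ e Y = k := real_inner_comm _ _
    have hi : ρ * ρ⁻¹ = 1 := mul_inv_cancel₀ hρ.ne'
    have hi2 : ρ * ρ * (ρ⁻¹ * ρ⁻¹) = 1 := by rw [mul_mul_mul_comm, hi, one_mul]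
    refine ⟨ρ⁻¹ • Y, ρ⁻¹ • ((2 * k) • e - Y), ?_, ?_, ?_, ?_⟩
    · simp only [inner_smul_left, inner_smul_right, conj_trivial, hYY]
      linear_combination hi2
    · simp only [inner_smul_left, inner_smul_right, inner_sub_left, inner_sub_right, conj_trivial,
        hYY, he, hk', ← hk]
      linear_combination hi2
    · simp only [inner_smul_left, inner_smul_right, inner_sub_left, inner_sub_right, conj_trivial,
        hYY, he, hk', ← hk]
      linear_combination ρ⁻¹ * ρ⁻¹ * hY0
    · intro z
      have h1 : x + z = y + (z - Y) := by rw [hY]; abel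
      rw [h1, hC]
      have hYz : inner ℝ Y z = inner ℝ z Y := real_inner_comm _ _
      simp only [inner_smul_left, inner_smul_right, inner_sub_left, inner_sub_right, conj_trivial,
        hYY, he, hk', ← hk, hYz]
      set a := inner ℝ z e
      set b := inner ℝ z Y
      have h3 : (ρ⁻¹ * b + ρ⁻¹ * (2 * k * a - b))^2 = 2 * a^2 := by
        linear_combination 2 * a^2 * hi2 + 2 * a^2 * ρ⁻¹ * ρ⁻¹ * hY0
      have h4 : 2 * ρ * (ρ⁻¹ * (2 * k * a - b)) = 2 * (2 * k * a - b) := by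
        linear_combination 2 * (2 * k * a - b) * hi
      rw [h3, h4]
      constructor
      · intro h; linear_combination h - hY0
      · intro h; linear_combination h + hY0

lemma aux_base_mem {y : E 4} {C : Set (E 4)} (h : IsKPCone (le_refl 4) y C) : y ∈ C := by
  obtain ⟨e, v, he, hv, hev, hC⟩ := aux_kp h
  have := (hC 0).2 (by simp)
  simpa using this
lemma aux_exists_perp (μ ν : E 4) :
    ∃ u : E 4, inner ℝ u u = (1 : ℝ) ∧ inner ℝ u μ = (0 : ℝ) ∧ inner ℝ u ν = (0 : ℝ) := by
  have hlt : Module.finrank ℝ (Submodule.span ℝ ({μ, ν} : Set (E 4))) < 4 := by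
    have := finrank_span_le_card (R := ℝ) ({μ, ν} : Set (E 4))
    refine this.trans_lt ?_
    have h2 : ({μ, ν} : Set (E 4)).toFinset.card ≤ 2 := by
      rw [Set.toFinset_insert, Set.toFinset_singleton]; exact Finset.card_le_two
    omega
  have hne : (Submodule.span ℝ ({μ, ν} : Set (E 4)))ᗮ ≠ ⊥ := by
    intro hb
    have := Submodule.finrank_add_finrank_orthogonal (Submodule.span ℝ ({μ, ν} : Set (E 4)))
    rw [hb, finrank_bot] at this
    simp at this
    omega
  obtain ⟨w, hw, hw0⟩ := Submodule.exists_mem_ne_zero_of_ne_bot hne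
  rw [Submodule.mem_orthogonal'] at hw
  have h1 := hw μ (Submodule.subset_span (by simp))
  have h2 := hw ν (Submodule.subset_span (by simp))
  have h0 : 0 < ‖w‖ := norm_pos_iff.2 hw0
  refine ⟨‖w‖⁻¹ • w, ?_, ?_, ?_⟩
  · rw [inner_smul_left, inner_smul_right, real_inner_self_eq_norm_mul_norm]
    simp; field_simp
  · rw [inner_smul_left, h1, mul_zero]
  · rw [inner_smul_left, h2, mul_zero]

lemma aux_decomp (μ ν n : E 4) (hμ : inner ℝ μ μ = (1 : ℝ)) (hν : inner ℝ ν ν = (1 : ℝ))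
    (hμν : inner ℝ μ ν = (0 : ℝ)) :
    ∃ (u : E 4) (α β γ : ℝ), inner ℝ u u = (1 : ℝ) ∧ inner ℝ u μ = (0 : ℝ) ∧
      inner ℝ u ν = (0 : ℝ) ∧ n = α • ν + β • μ + γ • u := by
  have hνμ : inner ℝ ν μ = (0 : ℝ) := by rw [real_inner_comm]; exact hμν
  set w := n - (inner ℝ n ν : ℝ) • ν - (inner ℝ n μ : ℝ) • μ with hw
  by_cases hw0 : w = 0
  · obtain ⟨u, h1, h2, h3⟩ := aux_exists_perp μ ν
    refine ⟨u, inner ℝ n ν, inner ℝ n μ, 0, h1, h2, h3, ?_⟩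
    have : n = w + (inner ℝ n ν : ℝ) • ν + (inner ℝ n μ : ℝ) • μ := by rw [hw]; abel
    rw [hw0] at this
    simpa using this
  · have h0 : 0 < ‖w‖ := norm_pos_iff.2 hw0
    refine ⟨‖w‖⁻¹ • w, inner ℝ n ν, inner ℝ n μ, ‖w‖, ?_, ?_, ?_, ?_⟩
    · rw [inner_smul_left, inner_smul_right, real_inner_self_eq_norm_mul_norm]
      simp; field_simp
    · rw [inner_smul_left, hw]
      simp only [inner_sub_left, inner_smul_left, hμ, hνμ, conj_trivial]; ring
    · rw [inner_smul_left, hw]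
      simp only [inner_sub_left, inner_smul_left, hν, hμν, conj_trivial]; ring
    · rw [smul_smul, mul_inv_cancel₀ h0.ne', one_smul, hw]; abel

lemma aux_abs_pm {k p q c : ℝ} (hk : 0 ≤ k) (h1 : k * |p + q| ≤ c) (h2 : k * |-p + q| ≤ c) :
    k * |p| ≤ c ∧ k * |q| ≤ c := by
  constructor
  · have : 2 * |p| ≤ |p + q| + |-p + q| := by
      have := abs_sub (p + q) (-p + q)
      rw [show p + q - (-p + q) = 2 * p by ring, abs_mul, abs_two] at this
      exact this
    nlinarith
  · have : 2 * |q| ≤ |p + q| + |-p + q| := by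
      have := abs_add_le (p + q) (-p + q)
      rw [show p + q + (-p + q) = 2 * q by ring, abs_mul, abs_two] at this
      exact this
    nlinarith

lemma aux_key (μ ν n : E 4) (hμ : inner ℝ μ μ = (1 : ℝ)) (hν : inner ℝ ν ν = (1 : ℝ))
    (hμν : inner ℝ μ ν = (0 : ℝ)) (hn : inner ℝ n n = (1 : ℝ)) (ρ s M : ℝ) (hρ : 0 ≤ ρ)
    (hs : 0 < s) (hM : 10 ≤ M)
    (H : ∀ z : E 4, (inner ℝ z μ + inner ℝ z ν) ^ 2 - inner ℝ z z = 2 * ρ * inner ℝ z ν →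
      inner ℝ z z ≤ s ^ 2 → M * s * |inner ℝ z n| ≤ inner ℝ z z / 4 + s ^ 2 / 60) :
    M * s ≤ ρ := by
  by_contra! hlt
  obtain ⟨u, α, β, γ, hu, huμ, huν, rfl⟩ := aux_decomp μ ν n hμ hν hμν
  have hνμ : inner ℝ ν μ = (0 : ℝ) := by rw [real_inner_comm]; exact hμν
  have hμu : inner ℝ μ u = (0 : ℝ) := by rw [real_inner_comm]; exact huμ
  have hνu : inner ℝ ν u = (0 : ℝ) := by rw [real_inner_comm]; exact huν
  have hsum : α ^ 2 + β ^ 2 + γ ^ 2 = 1 := by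
    simp only [inner_add_left, inner_add_right, inner_smul_left, inner_smul_right, conj_trivial,
      hμ, hν, hu, hμν, hνμ, hμu, huμ, hνu, huν] at hn
    linear_combination hn
  have T : ∀ a b c : ℝ, 2 * b * (c - ρ) = a ^ 2 → a ^ 2 + b ^ 2 + c ^ 2 ≤ s ^ 2 →
      M * s * |a * γ + (b * α + c * β)| ≤ (a ^ 2 + b ^ 2 + c ^ 2) / 4 + s ^ 2 / 60 := by
    intro a b c h1 h2
    have e1 : inner ℝ (a • u + b • ν + c • μ) μ = c := by
      simp only [inner_add_left, inner_smul_left, conj_trivial, hμ, hνμ, huμ]; ring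
    have e2 : inner ℝ (a • u + b • ν + c • μ) ν = b := by
      simp only [inner_add_left, inner_smul_left, conj_trivial, hν, hμν, huν]; ring
    have e3 : inner ℝ (a • u + b • ν + c • μ) u = a := by
      simp only [inner_add_left, inner_smul_left, conj_trivial, hu, hμu, hνu]; ring
    have e4 : inner ℝ (a • u + b • ν + c • μ) (a • u + b • ν + c • μ) = a ^ 2 + b ^ 2 + c ^ 2 := by
      rw [inner_add_right, inner_add_right, inner_smul_right, inner_smul_right, inner_smul_right,
        e1, e2, e3]; ring
    have e5 : inner ℝ (a • u + b • ν + c • μ) (α • ν + β • μ + γ • u)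
        = a * γ + (b * α + c * β) := by
      rw [inner_add_right, inner_add_right, inner_smul_right, inner_smul_right, inner_smul_right,
        e1, e2, e3]; ring
    have := H (a • u + b • ν + c • μ) (by rw [e1, e2, e4]; linear_combination h1) (by rw [e4]; exact h2)
    rwa [e4, e5] at this
  have hMs : 0 < M * s := by positivity
  have hs2 : 0 < s ^ 2 := by positivity
  have t1 := T 0 0 s (by ring) (by linarith)
  have hβ : M * |β| ≤ 16 / 60 := by
    rw [show (0 : ℝ) * γ + (0 * α + s * β) = s * β by ring, abs_mul, abs_of_pos hs] at t1
    have : s ^ 2 * (M * |β|) ≤ s ^ 2 * (16 / 60) := by linarith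
    exact le_of_mul_le_mul_left this hs2
  have hβ' : |β| ≤ 0.03 := by linarith [mul_nonneg (sub_nonneg.2 hM) (abs_nonneg β)]
  rcases le_or_gt (s / 2) ρ with hc | hc
  · have hρ0 : 0 < ρ := by linarith
    obtain ⟨k, hk0, hk⟩ : ∃ k : ℝ, 0 < k ∧ 8 * ρ * k = s ^ 2 :=
      ⟨s ^ 2 / (8 * ρ), by positivity, by field_simp⟩
    have hks : k ≤ s / 4 := by
      by_contra! h
      have := mul_lt_mul_of_pos_left h hρ0
      have := mul_le_mul_of_nonneg_right hc hs.le
      linarith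
    have hk2 : k ^ 2 ≤ s ^ 2 / 16 := by
      have := pow_le_pow_left₀ hk0.le hks 2
      linarith
    have t2 := T (s / 2) (-k) 0 (by linear_combination (1/4) * hk) (by linarith)
    have t3 := T (-(s / 2)) (-k) 0 (by linear_combination (1/4) * hk) (by linarith)
    have hbd : ((s / 2) ^ 2 + (-k) ^ 2 + 0 ^ 2) / 4 + s ^ 2 / 60 ≤ 0.095 * s ^ 2 := by linarith
    have hbd' : ((-(s / 2)) ^ 2 + (-k) ^ 2 + 0 ^ 2) / 4 + s ^ 2 / 60 ≤ 0.095 * s ^ 2 := by linarith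
    rw [neg_mul] at t3
    obtain ⟨g1, g2⟩ := aux_abs_pm hMs.le (t2.trans hbd) (t3.trans hbd')
    rw [abs_mul, abs_of_pos (by positivity : 0 < s / 2)] at g1
    have hγ : M * |γ| ≤ 0.19 := by
      have : s ^ 2 * (M * |γ|) ≤ s ^ 2 * 0.19 := by linarith
      exact le_of_mul_le_mul_left this hs2
    have hγ' : |γ| ≤ 0.03 := by linarith [mul_nonneg (sub_nonneg.2 hM) (abs_nonneg γ)]
    rw [zero_mul, add_zero, neg_mul, abs_neg, abs_mul, abs_of_pos hk0, ← hk] at g2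
    have g3 : k * (M * s * |α|) ≤ k * (0.76 * ρ) := by linarith
    have g4 := le_of_mul_le_mul_left g3 hk0
    have g5 : M * s * |α| ≤ M * s * 0.76 := by linarith
    have hα := le_of_mul_le_mul_left g5 hMs
    have q1 := pow_le_pow_left₀ (abs_nonneg α) hα 2
    have q2 := pow_le_pow_left₀ (abs_nonneg β) hβ' 2
    have q3 := pow_le_pow_left₀ (abs_nonneg γ) hγ' 2
    rw [sq_abs] at q1 q2 q3
    norm_num at q1 q2 q3
    linarith
  · have hg : (ρ - s / 2) ^ 2 ≤ s ^ 2 / 4 := by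
      have := mul_nonneg hρ (by linarith : 0 ≤ s - ρ)
      linarith
    have t2 := T (s / 2) (-(s / 4)) (ρ - s / 2) (by ring) (by linarith)
    have t3 := T (-(s / 2)) (-(s / 4)) (ρ - s / 2) (by ring) (by linarith)
    have hbd : ((s / 2) ^ 2 + (-(s / 4)) ^ 2 + (ρ - s / 2) ^ 2) / 4 + s ^ 2 / 60 ≤ 0.27 * s ^ 2 := by
      linarith
    have hbd' : ((-(s / 2)) ^ 2 + (-(s / 4)) ^ 2 + (ρ - s / 2) ^ 2) / 4 + s ^ 2 / 60
        ≤ 0.27 * s ^ 2 := by linarith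
    rw [neg_mul] at t3
    obtain ⟨g1, g2⟩ := aux_abs_pm hMs.le (t2.trans hbd) (t3.trans hbd')
    have R : ∀ p : ℝ, M * s * |p| ≤ 0.27 * s ^ 2 → |p| ≤ 0.03 * s := by
      intro p hp
      have h1 : s * (M * |p|) ≤ s * (0.27 * s) := by linarith
      have h2 := le_of_mul_le_mul_left h1 hs
      linarith [mul_nonneg (sub_nonneg.2 hM) (abs_nonneg p)]
    have g1' := R _ g1
    have g2' := R _ g2
    rw [abs_mul, abs_of_pos (by positivity : 0 < s / 2)] at g1'
    have hγ : |γ| ≤ 0.06 := by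
      have : s * |γ| ≤ s * 0.06 := by linarith
      exact le_of_mul_le_mul_left this hs
    have hα : |α| ≤ 0.2 := by
      have h1 : |(ρ - s / 2) * β| ≤ s / 2 * 0.03 := by
        rw [abs_mul]
        exact mul_le_mul (by rw [abs_le]; constructor <;> linarith) hβ' (abs_nonneg _) (by positivity)
      have h2 : |s / 4 * α| ≤ 0.03 * s + s / 2 * 0.03 := by
        rw [abs_le] at g2' h1 ⊢
        constructor <;> linarith
      rw [abs_mul, abs_of_pos (by positivity : 0 < s / 4)] at h2
      have : s * |α| ≤ s * 0.2 := by linarith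
      exact le_of_mul_le_mul_left this hs
    have q1 := pow_le_pow_left₀ (abs_nonneg α) hα 2
    have q2 := pow_le_pow_left₀ (abs_nonneg β) hβ' 2
    have q3 := pow_le_pow_left₀ (abs_nonneg γ) hγ 2
    rw [sq_abs] at q1 q2 q3
    norm_num at q1 q2 q3
    linarith

/-- upper bound for cone points -/
lemma aux_cone_bd (μ ν z : E 4) (hμ : inner ℝ μ μ = (1 : ℝ)) (hν : inner ℝ ν ν = (1 : ℝ))
    (hμν : inner ℝ μ ν = (0 : ℝ)) (ρ : ℝ) (hρ : 0 ≤ ρ)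
    (hz : (inner ℝ z μ + inner ℝ z ν) ^ 2 - inner ℝ z z = 2 * ρ * inner ℝ z ν) :
    2 * ρ * |inner ℝ z ν| ≤ ‖z‖ ^ 2 := by
  have hzz : inner ℝ z z = ‖z‖ ^ 2 := real_inner_self_eq_norm_sq z
  have h1 : (inner ℝ z μ) ^ 2 + (inner ℝ z ν) ^ 2 ≤ ‖z‖ ^ 2 := by
    have := real_inner_self_nonneg (x := z - (inner ℝ z μ : ℝ) • μ - (inner ℝ z ν : ℝ) • ν)
    have hνμ : inner ℝ ν μ = (0 : ℝ) := by rw [real_inner_comm]; exact hμν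
    have c1 : inner ℝ μ z = inner ℝ z μ := real_inner_comm _ _
    have c2 : inner ℝ ν z = inner ℝ z ν := real_inner_comm _ _
    simp only [inner_sub_left, inner_sub_right, inner_smul_left, inner_smul_right, conj_trivial,
      hμ, hν, hμν, hνμ, hzz, c1, c2] at this
    linarith
  have h2 : |2 * ρ * inner ℝ z ν| ≤ ‖z‖ ^ 2 := by
    rw [← hz, hzz, abs_le]
    constructor
    · nlinarith [sq_nonneg (inner ℝ z μ + inner ℝ z ν)]
    · nlinarith [sq_nonneg (inner ℝ z μ - inner ℝ z ν)]
  rwa [abs_mul, abs_of_nonneg (by positivity)] at h2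

lemma aux_unit {n : E 4} (hn : inner ℝ n n = (1 : ℝ)) : ‖n‖ = 1 := by
  have h : ‖n‖ ^ 2 = 1 := by rw [← real_inner_self_eq_norm_sq]; exact hn
  exact (pow_eq_one_iff_of_nonneg (norm_nonneg _) two_ne_zero).1 h

lemma aux_pert {p q n : E 4} (hn : inner ℝ n n = (1 : ℝ)) {h : ℝ} (hpq : ‖p - q‖ ≤ h) :
    |(inner ℝ p n : ℝ)| ≤ |(inner ℝ q n : ℝ)| + h := by
  have h1 : (inner ℝ p n : ℝ) = inner ℝ q n + inner ℝ (p - q) n := by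
    rw [inner_sub_left]; ring
  have h2 : |(inner ℝ (p - q) n : ℝ)| ≤ ‖p - q‖ := by
    have := abs_real_inner_le_norm (p - q) n
    rwa [aux_unit hn, mul_one] at this
  rw [h1]
  exact (abs_add_le _ _).trans (by linarith)

lemma aux_sq {p q : E 4} {s h : ℝ} (hp : ‖p‖ ≤ s) (hq : ‖q‖ ≤ s) (hpq : ‖p - q‖ ≤ h) :
    ‖p‖ ^ 2 ≤ ‖q‖ ^ 2 + 2 * s * h := by
  have h1 : ‖p‖ - ‖q‖ ≤ h := (norm_sub_norm_le p q).trans hpq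
  have h2 : 0 ≤ h := (norm_nonneg _).trans hpq
  have h3 : ‖p‖ ^ 2 - ‖q‖ ^ 2 = (‖p‖ - ‖q‖) * (‖p‖ + ‖q‖) := by ring
  have h4 : (‖p‖ - ‖q‖) * (‖p‖ + ‖q‖) ≤ h * (‖p‖ + ‖q‖) :=
    mul_le_mul_of_nonneg_right h1 (by positivity)
  have h5 : h * (‖p‖ + ‖q‖) ≤ h * (2 * s) := mul_le_mul_of_nonneg_left (by linarith) h2
  linarith

/-- flatness state at scale `r` -/
def auxSt (M : ℝ) (S : Set (E 4)) (x : E 4) (r : ℝ) : Prop :=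
  ∃ n : E 4, inner ℝ n n = (1 : ℝ) ∧ ∀ z ∈ S, ‖z - x‖ ≤ r →
    M * r * |(inner ℝ (z - x) n : ℝ)| ≤ ‖z - x‖ ^ 2 / 2 + r ^ 2 / 200

lemma aux_step {M : ℝ} (hM : 10 ≤ M) {S : Set (E 4)} {x : E 4} {s : ℝ} (hs : 0 < s)
    (hx : x ∈ S) (hst : auxSt M S x (2 * s))
    (hth : varthetaC (le_refl 4) S x s < 1 / (1000 * M)) :
    ∃ (C : Set (E 4)) (ρ : ℝ) (μ ν : E 4), M * s ≤ ρ ∧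
      inner ℝ μ μ = (1 : ℝ) ∧ inner ℝ ν ν = (1 : ℝ) ∧ inner ℝ μ ν = (0 : ℝ) ∧
      (∀ z, x + z ∈ C ↔ (inner ℝ z μ + inner ℝ z ν) ^ 2 - inner ℝ z z = 2 * ρ * inner ℝ z ν) ∧
      (∀ a ∈ C, dist a x ≤ s → ∃ b ∈ S, dist b x ≤ s ∧ dist a b ≤ 1 / (1000 * M) * s) ∧
      (∀ z ∈ S, ‖z - x‖ ≤ s →
        M * s * |(inner ℝ (z - x) ν : ℝ)| ≤ ‖z - x‖ ^ 2 / 2 + s ^ 2 / 200) := by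
  have hM0 : 0 < M := by linarith
  have hne : Nonempty {C : Set (E 4) // (∃ y, IsKPCone (le_refl 4) y C) ∧ x ∈ C} := by
    by_contra h
    rw [not_nonempty_iff] at h
    refine h.false ⟨{z | z - x ∈ stdKP 4 (le_refl 4)}, ⟨x, LinearIsometryEquiv.refl ℝ _, ?_⟩, ?_⟩
    · ext z; simp
    · simp [stdKP]
  obtain ⟨⟨C, ⟨y, hy⟩, hxC⟩, hC⟩ := exists_lt_of_ciInf_lt hth
  obtain ⟨hSC, hCS⟩ := aux_Dxr_lt x s hs S C _ hx hxC hC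
  obtain ⟨μ, ν, hμ, hν, hμν, hfr⟩ := aux_frame hy hxC
  obtain ⟨n, hn, hst⟩ := hst
  obtain ⟨ε, hε, hεM, hε0, hε1⟩ : ∃ ε : ℝ, 1 / (1000 * M) = ε ∧ M * ε = 1 / 1000 ∧ 0 < ε ∧
      ε ≤ 1 / 10000 := by
    refine ⟨_, rfl, by field_simp, by positivity, ?_⟩
    apply one_div_le_one_div_of_le <;> linarith
  rw [hε] at hSC hCS ⊢
  have hs2 : 0 < s ^ 2 := by positivity
  have hεs : ε * s ^ 2 ≤ s ^ 2 / 10000 := by nlinarith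
  have hMs : 0 ≤ M * s := by positivity
  have key : M * s ≤ ‖y - x‖ := by
    refine aux_key μ ν n hμ hν hμν hn _ s M (norm_nonneg _) hs hM ?_
    intro z hz hzs
    rw [real_inner_self_eq_norm_sq] at hzs ⊢
    have hzs' : ‖z‖ ≤ s := (sq_le_sq₀ (norm_nonneg _) hs.le).1 hzs
    obtain ⟨b, hbS, hb1, hb2⟩ := hCS (x + z) ((hfr z).2 hz) (by simpa [dist_eq_norm] using hzs')
    rw [dist_eq_norm] at hb1 hb2
    have hd : ‖z - (b - x)‖ ≤ ε * s := by
      rwa [show z - (b - x) = x + z - b by abel]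
    have hd' : ‖b - x - z‖ ≤ ε * s := by rwa [norm_sub_rev]
    have g1 := hst b hbS (by linarith)
    have g2 := mul_le_mul_of_nonneg_left (aux_pert hn hd) hMs
    have g3 := aux_sq hb1 hzs' hd'
    have g4 : M * s * (ε * s) = s ^ 2 / 1000 := by linear_combination s ^ 2 * hεM
    linarith
  refine ⟨C, ‖y - x‖, μ, ν, key, hμ, hν, hμν, hfr, hCS, ?_⟩
  intro z hz hzs
  obtain ⟨c, hc, hc1, hc2⟩ := hSC z hz (by simpa [dist_eq_norm] using hzs)
  rw [dist_eq_norm] at hc1 hc2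
  have hcc := aux_cone_bd μ ν (c - x) hμ hν hμν _ (norm_nonneg _) ((hfr _).1 (by simpa using hc))
  have hd : ‖(z - x) - (c - x)‖ ≤ ε * s := by simpa using hc2
  have hd' : ‖(c - x) - (z - x)‖ ≤ ε * s := by rwa [norm_sub_rev]
  have g2 := mul_le_mul_of_nonneg_left (aux_pert hν hd) hMs
  have g3 := aux_sq hc1 hzs hd'
  have g4 : M * s * (ε * s) = s ^ 2 / 1000 := by linear_combination s ^ 2 * hεM
  have g5 := mul_le_mul_of_nonneg_right key (abs_nonneg (inner ℝ (c - x) ν : ℝ))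
  linarith

lemma aux_base {M : ℝ} (hM : 10 ≤ M) {S : Set (E 4)} {x x₀ : E 4} {r₀ s : ℝ} (hr₀ : 0 < r₀)
    (hx : x ∈ S) (hx₀ : x₀ ∈ S) {C : Set (E 4)} (hC : IsKPCone (le_refl 4) x₀ C) {η : ℝ}
    (hD : Dxr x₀ r₀ S C < η) (h1 : r₀ / 3 ≤ ‖x - x₀‖) (h2 : ‖x - x₀‖ ≤ 2 * r₀ / 3)
    (hη : η ≤ 1 / 12) (hηs : η * r₀ ≤ s / (4000 * M)) (hs : M * s ≤ r₀ / 4) (hs' : s ≤ r₀ / 3)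
    (hs0 : 0 < s) : auxSt M S x s := by
  have hM0 : 0 < M := by linarith
  obtain ⟨hSC, -⟩ := aux_Dxr_lt x₀ r₀ hr₀ S C _ hx₀ (aux_base_mem hC) hD
  obtain ⟨x', hx', -, hxx'⟩ := hSC x hx (by rw [dist_eq_norm]; linarith)
  obtain ⟨μ, ν, hμ, hν, hμν, hfr⟩ := aux_frame hC hx'
  set h := η * r₀
  rw [dist_eq_norm] at hxx'
  have hh0 : 0 ≤ h := (norm_nonneg _).trans hxx'
  have hρ : r₀ / 4 ≤ ‖x₀ - x'‖ := by
    have e1 := norm_sub_le_norm_sub_add_norm_sub x x' x₀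
    rw [norm_sub_rev x' x₀] at e1
    have : h ≤ 1 / 12 * r₀ := mul_le_mul_of_nonneg_right hη hr₀.le
    linarith
  have hMh : M * h ≤ s / 4000 := by
    have := mul_le_mul_of_nonneg_left hηs hM0.le
    have e : M * (s / (4000 * M)) = s / 4000 := by field_simp
    linarith
  have hh1 : h ≤ s / 40000 := by nlinarith
  refine ⟨ν, hν, ?_⟩
  intro z hz hzs
  obtain ⟨c, hc, -, hzc⟩ := hSC z hz (by
    rw [dist_eq_norm]
    have := norm_sub_le_norm_sub_add_norm_sub z x x₀
    linarith)
  rw [dist_eq_norm] at hzc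
  have hcc := aux_cone_bd μ ν (c - x') hμ hν hμν _ (norm_nonneg _) ((hfr _).1 (by simpa using hc))
  have hd : ‖(z - x) - (c - x')‖ ≤ 2 * h := by
    rw [show (z - x) - (c - x') = (z - c) - (x - x') by abel]
    exact (norm_sub_le _ _).trans (by linarith)
  have hd' : ‖(c - x') - (z - x)‖ ≤ 2 * h := by rwa [norm_sub_rev]
  have hcs : ‖c - x'‖ ≤ 2 * s := by
    have := norm_sub_norm_le (c - x') (z - x)
    linarith
  have hMs : 0 ≤ M * s := by positivity
  have g2 := mul_le_mul_of_nonneg_left (aux_pert hν hd) hMs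
  have g3 := aux_sq hcs (by linarith : ‖z - x‖ ≤ 2 * s) hd'
  have g5 := mul_le_mul_of_nonneg_right (hs.trans hρ) (abs_nonneg (inner ℝ (c - x') ν : ℝ))
  have g6 := mul_le_mul_of_nonneg_left hMh hs0.le
  have g7 := mul_le_mul_of_nonneg_left hh1 hs0.le
  have hs2 : 0 < s ^ 2 := by positivity
  linarith

lemma aux_final {M δ : ℝ} (hM : 10 ≤ M) (hδ : 10 ≤ M * δ) {S : Set (E 4)} {x : E 4} {r : ℝ}
    (hr : 0 < r) (hx : x ∈ S) (hst : auxSt M S x (2 * r))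
    (hth : varthetaC (le_refl 4) S x r < 1 / (1000 * M)) : thetaP 3 S x r < δ := by
  have hM0 : 0 < M := by linarith
  obtain ⟨C, ρ, μ, ν, hρ, hμ, hν, hμν, hfr, hCS, hfl⟩ := aux_step hM hr hx hst hth
  have hν0 : ν ≠ 0 := by rintro rfl; simp at hν
  have : Fact (Module.finrank ℝ (E 4) = 3 + 1) := ⟨by simp⟩
  obtain ⟨ε, hε, hεM⟩ : ∃ ε : ℝ, 1 / (1000 * M) = ε ∧ M * ε = 1 / 1000 :=
    ⟨_, rfl, by field_simp⟩
  rw [hε] at hCS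
  let L : AffineSubspace ℝ (E 4) := AffineSubspace.mk' x (ℝ ∙ ν)ᗮ
  have hLd : Module.finrank ℝ L.direction = 3 := by
    rw [AffineSubspace.direction_mk']
    exact Submodule.finrank_orthogonal_span_singleton hν0
  have hLm : ∀ p, p ∈ L ↔ inner ℝ ν (p - x) = (0 : ℝ) := by
    intro p
    rw [AffineSubspace.mem_mk', Submodule.mem_orthogonal_singleton_iff_inner_right]; rfl
  have hbdd : BddBelow (Set.range fun L : {L : AffineSubspace ℝ (E 4) // x ∈ L ∧
      Module.finrank ℝ L.direction = 3} => Dxr x r S (L.1 : Set (E 4))) := by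
    refine ⟨0, ?_⟩
    rintro _ ⟨L, rfl⟩
    exact (aux_dxr_nonneg x r hr _ _).trans (le_max_left _ _)
  have hmain : Dxr x r S (L : Set (E 4)) ≤ 3 / M := by
    refine max_le ?_ ?_
    · refine aux_dxr_le x r hr _ _ _ (by positivity) ?_
      intro a ha har
      rw [dist_eq_norm] at har
      set t : ℝ := inner ℝ (a - x) ν with ht
      have ht' : inner ℝ ν (a - x) = t := real_inner_comm _ _
      refine ⟨a - t • ν, ?_, ?_, ?_⟩
      · show _ ∈ L
        rw [hLm, show a - t • ν - x = (a - x) - t • ν by abel, inner_sub_right, inner_smul_right,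
          hν, ht']; ring
      · rw [dist_eq_norm, show a - t • ν - x = (a - x) - t • ν by abel]
        refine le_trans ?_ har
        rw [← sq_le_sq₀ (norm_nonneg _) (norm_nonneg _), ← real_inner_self_eq_norm_sq,
          ← real_inner_self_eq_norm_sq]
        have e : inner ℝ (a - x - t • ν) (a - x - t • ν) = inner ℝ (a - x) (a - x) - t ^ 2 := by
          generalize a - x = q at ht ht'
          simp only [inner_sub_left, inner_sub_right, inner_smul_right, inner_smul_left,
            conj_trivial, hν, ht', ← ht]
          ring
        rw [e]
        linarith [sq_nonneg t]
      · rw [dist_eq_norm, sub_sub_cancel, norm_smul, aux_unit hν, mul_one, Real.norm_eq_abs]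
        have h1 := hfl a ha har
        have h2 : ‖a - x‖ ^ 2 ≤ r ^ 2 := pow_le_pow_left₀ (norm_nonneg _) har 2
        rw [div_mul_eq_mul_div, le_div_iff₀ hM0]
        have h3 : r * (|t| * M) ≤ r * (3 * r) := by nlinarith
        exact le_of_mul_le_mul_left h3 hr
    · refine aux_dxr_le x r hr _ _ _ (by positivity) ?_
      intro a ha har
      rw [dist_eq_norm] at har
      have ha' : inner ℝ ν (a - x) = (0 : ℝ) := (hLm a).1 ha
      set p := (1 - 1 / M) • (a - x) with hp
      have hpν : inner ℝ p ν = (0 : ℝ) := by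
        rw [hp, inner_smul_left, real_inner_comm, ha', mul_zero]
      have hνp : inner ℝ ν p = (0 : ℝ) := by rw [real_inner_comm]; exact hpν
      have hiM : 0 < 1 / M := by positivity
      have hiM1 : 1 / M ≤ 1 / 10 := one_div_le_one_div_of_le (by norm_num) hM
      have hpn : ‖p‖ ≤ (1 - 1 / M) * r := by
        rw [hp, norm_smul, Real.norm_of_nonneg (by linarith)]
        exact mul_le_mul_of_nonneg_left har (by linarith)
      have hpr : ‖p‖ ≤ r := hpn.trans (by nlinarith)
      have hpa : ‖a - x - p‖ ≤ 1 / M * r := by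
        rw [hp, show (a - x) - (1 - 1 / M) • (a - x) = (1 / M) • (a - x) by module, norm_smul,
          Real.norm_of_nonneg hiM.le]
        exact mul_le_mul_of_nonneg_left har hiM.le
      set k : ℝ := inner ℝ p μ with hk
      have hkr : |k| ≤ ‖p‖ := by
        have := abs_real_inner_le_norm p μ
        rwa [aux_unit hμ, mul_one] at this
      have hkr' := abs_le.1 hkr
      have hMr : 10 * r ≤ M * r := mul_le_mul_of_nonneg_right hM hr.le
      have hden : 0 < ρ - k := by linarith
      obtain ⟨t, ht⟩ : ∃ t : ℝ, 2 * t * (ρ - k) = k ^ 2 - ‖p‖ ^ 2 :=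
        ⟨(k ^ 2 - ‖p‖ ^ 2) / (2 * (ρ - k)), by field_simp⟩
      have htb : |t| ≤ 1 / M * r := by
        have h1 : 2 * |t| * (ρ - k) ≤ r ^ 2 := by
          have : |2 * t * (ρ - k)| ≤ r ^ 2 := by
            rw [ht]
            have h3 : k ^ 2 ≤ ‖p‖ ^ 2 := sq_le_sq' hkr'.1 hkr'.2
            have h4 : ‖p‖ ^ 2 ≤ r ^ 2 := pow_le_pow_left₀ (norm_nonneg _) hpr 2
            rw [abs_le]; constructor
            · nlinarith [sq_nonneg k]
            · nlinarith [sq_nonneg r]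
          rwa [abs_mul, abs_mul, abs_two, abs_of_pos hden] at this
        have h2 : M * r / 2 ≤ ρ - k := by linarith
        have h3 : 2 * |t| * (M * r / 2) ≤ 2 * |t| * (ρ - k) :=
          mul_le_mul_of_nonneg_left h2 (by positivity)
        have h4 : r * (|t| * M) ≤ r * (1 * r) := by nlinarith
        rw [div_mul_eq_mul_div, le_div_iff₀ hM0]
        exact le_of_mul_le_mul_left h4 hr
      have htn : ‖t • ν‖ ≤ 1 / M * r := by
        rw [norm_smul, aux_unit hν, mul_one, Real.norm_eq_abs]; exact htb
      have hz : x + (p + t • ν) ∈ C := by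
        rw [hfr]
        have hpp : inner ℝ p p = ‖p‖ ^ 2 := real_inner_self_eq_norm_sq p
        have hνμ : inner ℝ ν μ = (0 : ℝ) := by rw [real_inner_comm]; exact hμν
        simp only [inner_add_left, inner_add_right, inner_smul_left, inner_smul_right,
          conj_trivial, hpp, hνμ, hν, hpν, hνp, ← hk]
        linear_combination -ht
      obtain ⟨b, hbS, hb1, hb2⟩ := hCS _ hz (by
        rw [dist_eq_norm, add_sub_cancel_left]
        exact (norm_add_le _ _).trans (by linarith))
      refine ⟨b, hbS, hb1, ?_⟩
      rw [dist_eq_norm] at hb2 ⊢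
      have e : a - b = (a - x - p) - t • ν + (x + (p + t • ν) - b) := by abel
      rw [e]
      have e1 := norm_add_le ((a - x - p) - t • ν) (x + (p + t • ν) - b)
      have e2 := norm_sub_le (a - x - p) (t • ν)
      have e3 : ε * r ≤ 1 / M * r := by
        rw [← hε]
        refine mul_le_mul_of_nonneg_right (one_div_le_one_div_of_le hM0 (by linarith)) hr.le
      have e4 : 3 / M * r = 3 * (1 / M * r) := by ring
      linarith
  have h3 : 3 / M < δ := by
    rw [div_lt_iff₀ hM0]; linarith
  exact ((ciInf_le hbdd ⟨L, AffineSubspace.self_mem_mk' _ _, hLd⟩).trans hmain).trans_lt h3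

/-- Corollary 2.13 / `FlatSidesSet`: flatness of the sides of a set well
approximated by KP cones. -/
theorem flat_sides_of_kp_approx_set (δ : ℝ) (hδ : 0 < δ) :
    ∃ A ε η : ℝ, 0 < A ∧ 0 < ε ∧ 0 < η ∧
      ∀ (S : Set (E 4)) (x₀ : E 4), x₀ ∈ S → ∀ r₀ : ℝ, 0 < r₀ →
        (∀ x ∈ S ∩ closedBall x₀ r₀, ∀ r : ℝ, 0 < r → r ≤ r₀ →
          varthetaC (le_refl 4) S x r < ε) →
        ∀ C : Set (E 4), IsKPCone (le_refl 4) x₀ C → Dxr x₀ r₀ S C < η →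
        ∀ x ∈ S, r₀ / 3 ≤ ‖x - x₀‖ → ‖x - x₀‖ ≤ 2 * r₀ / 3 →
          ∀ r : ℝ, 0 < r → r ≤ ‖x - x₀‖ / A → thetaP 3 S x r < δ := by
  obtain ⟨M, hM, hMδ⟩ : ∃ M : ℝ, 10 ≤ M ∧ 10 ≤ M * δ := by
    refine ⟨10 + 10 / δ, by have : 0 < 10 / δ := by positivity
                            linarith, ?_⟩
    have : (10 + 10 / δ) * δ = 10 * δ + 10 := by field_simp
    linarith
  have hM0 : 0 < M := by linarith
  refine ⟨16 * M, 1 / (1000 * M), 1 / (4000 * M * (48 * M)), by positivity, by positivity,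
    by positivity, ?_⟩
  intro S x₀ hx₀ r₀ hr₀ hth C hC hD x hx h1 h2 r hr hrA
  have hxB : x ∈ S ∩ closedBall x₀ r₀ := ⟨hx, by
    rw [mem_closedBall, dist_eq_norm]; linarith⟩
  set R := ‖x - x₀‖ / (16 * M) with hR
  have hRm : R * (16 * M) = ‖x - x₀‖ := by rw [hR]; field_simp
  have hR0 : 0 < R := by rw [hR]; have : 0 < ‖x - x₀‖ := by linarith
                         positivity
  have hR1 : 10 * R ≤ M * R := mul_le_mul_of_nonneg_right hM hR0.le
  have claim : ∀ k : ℕ, ∀ s : ℝ, 0 < s → R < 2 ^ k * s → 2 ^ k * s ≤ 2 * R → auxSt M S x s := by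
    intro k
    induction k with
    | zero =>
      intro s hs ha hb
      rw [pow_zero, one_mul] at ha hb
      have hMs : M * s ≤ M * (2 * R) := mul_le_mul_of_nonneg_left hb hM0.le
      refine aux_base hM hr₀ hx hx₀ hC hD h1 h2 ?_ ?_ (by linarith) (by linarith) hs
      · refine one_div_le_one_div_of_le (by norm_num) ?_
        nlinarith
      · have : r₀ ≤ s * (48 * M) := by
          have := mul_le_mul_of_nonneg_left ha.le hM0.le
          linarith
        calc 1 / (4000 * M * (48 * M)) * r₀ ≤ 1 / (4000 * M * (48 * M)) * (s * (48 * M)) :=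
              mul_le_mul_of_nonneg_left this (by positivity)
          _ = s / (4000 * M) := by field_simp
    | succ k ih =>
      intro s hs ha hb
      rw [pow_succ, mul_assoc] at ha hb
      have hst := ih (2 * s) (by linarith) ha hb
      have h2k : 1 ≤ (2 : ℝ) ^ k := one_le_pow₀ (by norm_num)
      have hsR : 2 * s ≤ 2 * R := le_trans (by nlinarith) hb
      obtain ⟨C', ρ, μ, ν, -, -, hν, -, -, -, hfl⟩ :=
        aux_step hM hs hx hst (hth x hxB s hs (by linarith))
      exact ⟨ν, hν, hfl⟩
  obtain ⟨k, hk1, hk2⟩ := exists_nat_pow_near ((one_le_div hr).2 hrA) (one_lt_two)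
  rw [le_div_iff₀ hr] at hk1
  rw [div_lt_iff₀ hr] at hk2
  refine aux_final hM hMδ hr hx (claim k (2 * r) (by linarith) ?_ ?_) (hth x hxB r hr (by linarith))
  · rw [pow_succ] at hk2; linarith
  · linarith
end
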